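/- arXiv:1509.08675 — 3 statements merged into one kernel-verified Lean document; each statement's English description precedes it below -/
import Mathlib

section
/- Let 𝔄 be a unital associative algebra over ℝ and let (Q₁, …, Qₙ) be an n-tuple such that Q₁ is invertible and (Q₂Q₁⁻¹, …, QₙQ₁⁻¹) is a Clifford system. Then every Qᵢ is invertible, and for every index k ∈ {1, …, n}, both the (n−1)-tuple (QᵢQ_k⁻¹)_{i ≠ k} and the (n−1)-tuple (Q_k⁻¹Qᵢ)_{i ≠ k} are Clifford systems; equivalently, for all i ≠ k and j ≠ k one has QᵢQ_k⁻¹Qⱼ + QⱼQ_k⁻¹Qᵢ = −2δᵢⱼ·Q_k. In particular, the defining condition of a floating Clifford system is not specific to the index 1 nor to multiplication on the left or right. -/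
/-- A Clifford system: `QᵢQⱼ + QⱼQᵢ = −2δᵢⱼ·1`. -/
def IsCliffordSystem {𝔄 : Type*} [Ring 𝔄] {n : ℕ} (Q : Fin n → 𝔄) : Prop :=
  ∀ i j, Q i * Q j + Q j * Q i = if i = j then (-2 : 𝔄) else 0

/-- The entries of a Clifford system over `ℝ` square to `-1`. -/
lemma IsCliffordSystem.mul_self {𝔄 : Type*} [Ring 𝔄] [Algebra ℝ 𝔄] {n : ℕ} {E : Fin n → 𝔄}
    (hE : IsCliffordSystem E) (i : Fin n) : E i * E i = -1 := by
  have h : (2 : ℝ) • (E i * E i) = (2 : ℝ) • (-1 : 𝔄) := by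
    rw [two_smul, two_smul, hE i i, if_pos rfl, ← neg_add, one_add_one_eq_two]
  exact smul_right_injective 𝔄 (two_ne_zero' ℝ) h

/-- In a floating Clifford system all entries are invertible, and distinct entries satisfy the
index-symmetric relations `QᵢQⱼ⁻¹ + QⱼQᵢ⁻¹ = 0` and `Qᵢ⁻¹Qⱼ + Qⱼ⁻¹Qᵢ = 0`. -/
lemma IsCliffordSystem.isUnit_and_anticomm {𝔄 : Type*} [Ring 𝔄] [Algebra ℝ 𝔄] {n : ℕ}
    {Q : Fin (n + 1) → 𝔄} (h0 : IsUnit (Q 0))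
    (hQ : IsCliffordSystem (fun i : Fin n => Q i.succ * Ring.inverse (Q 0))) :
    (∀ i, IsUnit (Q i)) ∧
    ∀ i j, i ≠ j → Q i * Ring.inverse (Q j) + Q j * Ring.inverse (Q i) = 0 ∧
      Ring.inverse (Q i) * Q j + Ring.inverse (Q j) * Q i = 0 := by
  have hUV := Ring.mul_inverse_cancel _ h0
  have hVU := Ring.inverse_mul_cancel _ h0
  have hsq := hQ.mul_self
  unfold IsCliffordSystem at hQ
  set V := Ring.inverse (Q 0)
  have hr : ∀ i : Fin n, Q i.succ * (-(V * Q i.succ * V)) = 1 := by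
    intro i
    have := hsq i
    simp only [mul_neg, ← mul_assoc] at this ⊢
    rw [this, neg_neg]
  -- Conjugating by `Q 0` turns the relations for `Q i.succ * V` into those for `V * Q i.succ`.
  have conj : ∀ a b : 𝔄, V * a * (V * b) = V * ((a * V) * (b * V)) * Q 0 := by
    intro a b
    simp only [mul_assoc, hVU, mul_one]
  have hl : ∀ i : Fin n, -(V * Q i.succ * V) * Q i.succ = 1 := by
    intro i
    have := conj (Q i.succ) (Q i.succ)
    rw [hsq i, mul_neg_one, neg_mul, hVU] at this
    rw [neg_mul, mul_assoc, this, neg_neg]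
  have hunit : ∀ i : Fin n, IsUnit (Q i.succ) := fun i => ⟨⟨_, _, hr i, hl i⟩, rfl⟩
  have hinv : ∀ i : Fin n, Ring.inverse (Q i.succ) = -(V * Q i.succ * V) := by
    intro i
    exact left_inv_eq_right_inv (Ring.inverse_mul_cancel _ (hunit i)) (hr i)
  have hzero : ∀ j : Fin n,
      Q 0 * Ring.inverse (Q j.succ) + Q j.succ * V = 0 ∧
        V * Q j.succ + Ring.inverse (Q j.succ) * Q 0 = 0 := by
    intro j
    rw [hinv]
    constructor
    · rw [mul_neg, ← mul_assoc, ← mul_assoc, hUV, one_mul, neg_add_cancel]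
    · rw [neg_mul, mul_assoc _ V, hVU, mul_one, add_neg_cancel]
  refine ⟨Fin.cases h0 hunit, fun i j hij => ?_⟩
  cases i using Fin.cases with
  | zero =>
    cases j using Fin.cases with
    | zero => exact absurd rfl hij
    | succ j => exact hzero j
  | succ i =>
    cases j using Fin.cases with
    | zero =>
      obtain ⟨h1, h2⟩ := hzero i
      exact ⟨by rwa [add_comm], by rwa [add_comm]⟩
    | succ j =>
      have h := hQ i j
      rw [if_neg (fun e => hij (congrArg Fin.succ e))] at h
      rw [hinv, hinv]
      constructor
      · simp only [mul_neg, ← neg_add, ← mul_assoc] at h ⊢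
        rw [h, neg_zero]
      · rw [neg_mul, neg_mul, ← neg_add, mul_assoc _ V, mul_assoc _ V, conj, conj, ← add_mul,
          ← mul_add, h, mul_zero, zero_mul, neg_zero]

theorem stmt15 {𝔄 : Type*} [Ring 𝔄] [Algebra ℝ 𝔄] {n : ℕ}
    (Q : Fin (n + 1) → 𝔄) (h0 : IsUnit (Q 0))
    (hQ : IsCliffordSystem (fun i : Fin n => Q i.succ * Ring.inverse (Q 0))) :
    (∀ i, IsUnit (Q i)) ∧
    (∀ k i j, i ≠ k → j ≠ k →
      (Q i * Ring.inverse (Q k)) * (Q j * Ring.inverse (Q k)) +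
        (Q j * Ring.inverse (Q k)) * (Q i * Ring.inverse (Q k))
        = if i = j then (-2 : 𝔄) else 0) ∧
    (∀ k i j, i ≠ k → j ≠ k →
      (Ring.inverse (Q k) * Q i) * (Ring.inverse (Q k) * Q j) +
        (Ring.inverse (Q k) * Q j) * (Ring.inverse (Q k) * Q i)
        = if i = j then (-2 : 𝔄) else 0) ∧
    (∀ k i j, i ≠ k → j ≠ k →
      Q i * Ring.inverse (Q k) * Q j + Q j * Ring.inverse (Q k) * Q i
        = if i = j then -(2 * Q k) else 0) := by
  obtain ⟨hU, hR⟩ := hQ.isUnit_and_anticomm h0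
  have triple : ∀ k i j, i ≠ k → j ≠ k →
      Q i * Ring.inverse (Q k) * Q j + Q j * Ring.inverse (Q k) * Q i
        = if i = j then -(2 * Q k) else 0 := by
    intro k i j hi hj
    have flip : ∀ a b, b ≠ k → Q a * Ring.inverse (Q k) * Q b
        = -(Q a * Ring.inverse (Q b) * Q k) := by
      intro a b hb
      rw [mul_assoc, eq_neg_of_add_eq_zero_left (hR k b hb.symm).2, mul_neg, mul_assoc]
    rw [flip i j hj, flip j i hi, ← neg_add, ← add_mul]
    split_ifs with h
    · subst h
      rw [Ring.mul_inverse_cancel _ (hU i), one_add_one_eq_two]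
    · rw [(hR i j h).1, zero_mul, neg_zero]
  refine ⟨hU, fun k i j hi hj => ?_, fun k i j hi hj => ?_, triple⟩
  · have h := congrArg (· * Ring.inverse (Q k)) (triple k i j hi hj)
    simp only [add_mul, ite_mul, neg_mul, zero_mul, mul_assoc,
      Ring.mul_inverse_cancel _ (hU k), mul_one] at h ⊢
    exact h
  · have h := congrArg (Ring.inverse (Q k) * ·) (triple k i j hi hj)
    simp only [two_mul, mul_add, mul_ite, mul_neg, mul_zero,
      Ring.inverse_mul_cancel _ (hU k), one_add_one_eq_two] at h
    simpa only [mul_assoc] using h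
end

section
/- Let 𝔄 be a unital complex Banach algebra and let A₁, A₂ ∈ 𝔄 be such that a·A₁ + b·A₂ is invertible for every (a, b) ∈ ℝ² ∖ {(0,0)}. Then A₁A₂⁻¹ and A₂A₁⁻¹ have spectrum disjoint from ℝ, the elements C₁ := ½(A₁ + pol(A₁A₂⁻¹)·A₂) and C₂ := ½(A₂ + pol(A₂A₁⁻¹)·A₁) are both invertible, and (C₂·C₁⁻¹)² = −1; that is, (C₁, C₂) is a floating Clifford system. -/
/-- The polarization `pol H := (1/(2π)) ∫₀^{2π} ((−sin t)·1 + (cos t)·H)·((cos t)·1 + (sin t)·H)⁻¹ dt`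
in a unital complex Banach algebra. -/
noncomputable def pol {𝔄 : Type*} [NormedRing 𝔄] [NormedAlgebra ℂ 𝔄] [CompleteSpace 𝔄]
    (H : 𝔄) : 𝔄 :=
  (2 * Real.pi)⁻¹ • ∫ t in (0:ℝ)..(2 * Real.pi),
    ((-Real.sin t) • (1 : 𝔄) + (Real.cos t) • H) *
      Ring.inverse ((Real.cos t) • (1 : 𝔄) + (Real.sin t) • H)

theorem intervalIntegral_const_mul_of_continuous {A : Type*} [NormedRing A] [NormedAlgebra ℝ A]
    [CompleteSpace A] {f : ℝ → A} (hf : Continuous f) (a : A) (x y : ℝ) :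
    ∫ t in x..y, a * f t = a * ∫ t in x..y, f t :=
  (ContinuousLinearMap.mul ℝ A a).intervalIntegral_comp_comm (hf.intervalIntegrable x y)

theorem intervalIntegral_mul_const_of_continuous {A : Type*} [NormedRing A] [NormedAlgebra ℝ A]
    [CompleteSpace A] {f : ℝ → A} (hf : Continuous f) (a : A) (x y : ℝ) :
    ∫ t in x..y, f t * a = (∫ t in x..y, f t) * a :=
  ((ContinuousLinearMap.mul ℝ A).flip a).intervalIntegral_comp_comm (hf.intervalIntegrable x y)

namespace Polarization

open Real MeasureTheory

variable {A : Type*} [NormedRing A] [NormedAlgebra ℝ A]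

/-- The pencil `cos t + (sin t) H`. -/
noncomputable def pencil (H : A) (t : ℝ) : A := cos t • (1 : A) + sin t • H

/-- The derivative of `pencil H`. -/
noncomputable def dpencil (H : A) (t : ℝ) : A := (-sin t) • (1 : A) + cos t • H

/-- The logarithmic derivative of `pencil H`. -/
noncomputable def logDerivPencil (H : A) (t : ℝ) : A := dpencil H t * Ring.inverse (pencil H t)

/-- All members `cos t + (sin t) H` of the pencil are invertible, i.e. the spectrum of `H` does not
meet the real line. -/
def IsElliptic (H : A) : Prop := ∀ t : ℝ, IsUnit (pencil H t)

theorem commute_pencil (H : A) {K : A} (h : Commute K H) (t : ℝ) : Commute K (pencil H t) :=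
  ((Commute.one_right K).smul_right _).add_right (h.smul_right _)

theorem commute_dpencil (H : A) {K : A} (h : Commute K H) (t : ℝ) : Commute K (dpencil H t) :=
  ((Commute.one_right K).smul_right _).add_right (h.smul_right _)

theorem commute_inverse_pencil (H : A) {K : A} (h : Commute K H) (t : ℝ) :
    Commute K (Ring.inverse (pencil H t)) := by
  have hc := commute_pencil H h t
  by_cases hu : IsUnit (pencil H t)
  · obtain ⟨v, hv⟩ := hu
    rw [← hv] at hc ⊢
    rw [Ring.inverse_unit]
    exact hc.units_inv_right
  · rw [Ring.inverse_non_unit _ hu]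
    exact Commute.zero_right K

theorem commute_logDerivPencil (H : A) {K : A} (h : Commute K H) (t : ℝ) :
    Commute K (logDerivPencil H t) :=
  (commute_dpencil H h t).mul_right (commute_inverse_pencil H h t)

theorem continuous_pencil (H : A) : Continuous (pencil H) := by
  unfold pencil; fun_prop

theorem continuous_dpencil (H : A) : Continuous (dpencil H) := by
  unfold dpencil; fun_prop

theorem periodic_logDerivPencil (H : A) : Function.Periodic (logDerivPencil H) (2 * π) := by
  intro t
  simp [logDerivPencil, pencil, dpencil]

/-- The subtraction formula of the cotangent, for `logDerivPencil H`. -/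
theorem logDerivPencil_sub {H : A} (hH : IsElliptic H) (s u : ℝ) :
    sin u • (1 + logDerivPencil H s * logDerivPencil H (s + u)) =
      cos u • (logDerivPencil H s - logDerivPencil H (s + u)) := by
  have cHH : Commute H H := Commute.refl H
  have e₁ : pencil H s * Ring.inverse (pencil H s) = 1 := Ring.mul_inverse_cancel _ (hH s)
  have e₂ : pencil H (s + u) * Ring.inverse (pencil H (s + u)) = 1 :=
    Ring.mul_inverse_cancel _ (hH _)
  have c₁ : Commute (Ring.inverse (pencil H s)) (pencil H (s + u)) :=
    (commute_inverse_pencil H (commute_pencil H cHH _).symm s).symm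
  have c₂ : Commute (Ring.inverse (pencil H s)) (dpencil H (s + u)) :=
    (commute_inverse_pencil H (commute_dpencil H cHH _).symm s).symm
  have k₁ : sin u • (pencil H s * pencil H (s + u) + dpencil H s * dpencil H (s + u)) =
      cos u • (dpencil H s * pencil H (s + u) - dpencil H (s + u) * pencil H s) := by
    simp only [pencil, dpencil, sin_add, cos_add, mul_add, add_mul, smul_mul_assoc, mul_smul_comm,
      one_mul, mul_one]
    match_scalars <;> ring
  unfold logDerivPencil
  generalize pencil H s = g at *
  generalize pencil H (s + u) = g' at *
  generalize dpencil H s = d at *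
  generalize dpencil H (s + u) = d' at *
  have r₁ : 1 + d * Ring.inverse g * (d' * Ring.inverse g') =
      (g * g' + d * d') * (Ring.inverse g * Ring.inverse g') := by
    have a₁ : g * g' * (Ring.inverse g * Ring.inverse g') = 1 := by
      rw [mul_assoc, ← mul_assoc g', ← c₁.eq, mul_assoc _ g', e₂, mul_one, e₁]
    have a₂ : d * Ring.inverse g * (d' * Ring.inverse g') =
        d * d' * (Ring.inverse g * Ring.inverse g') := by
      rw [mul_assoc d, ← mul_assoc _ d', c₂.eq]
      simp only [mul_assoc]
    rw [add_mul, a₁, a₂]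
  have r₂ : d * Ring.inverse g - d' * Ring.inverse g' =
      (d * g' - d' * g) * (Ring.inverse g * Ring.inverse g') := by
    have a₁ : d * g' * (Ring.inverse g * Ring.inverse g') = d * Ring.inverse g := by
      rw [mul_assoc, ← mul_assoc g', ← c₁.eq, mul_assoc _ g', e₂, mul_one]
    have a₂ : d' * g * (Ring.inverse g * Ring.inverse g') = d' * Ring.inverse g' := by
      rw [mul_assoc, ← mul_assoc g, e₁, one_mul]
    rw [sub_mul, a₁, a₂]
  rw [r₁, r₂, ← smul_mul_assoc, k₁, smul_mul_assoc]

theorem integral_logDerivPencil_add (H : A) (s : ℝ) :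
    ∫ t in (0 : ℝ)..2 * π, logDerivPencil H (s + t) =
      ∫ t in (0 : ℝ)..2 * π, logDerivPencil H t := by
  rw [intervalIntegral.integral_comp_add_left (logDerivPencil H) s, add_zero,
    (periodic_logDerivPencil H).intervalIntegral_add_eq s 0, zero_add]

theorem integral_logDerivPencil_inv {H K : A} (hKH : K * H = 1) (hHK : H * K = 1) :
    ∫ t in (0 : ℝ)..2 * π, logDerivPencil K t = -∫ t in (0 : ℝ)..2 * π, logDerivPencil H t := by
  have hH : IsUnit H := ⟨⟨H, K, hHK, hKH⟩, rfl⟩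
  have hpt (t : ℝ) : logDerivPencil K t = -logDerivPencil H (π / 2 - t) := by
    have g : pencil H (π / 2 - t) = pencil K t * H := by
      simp [pencil, add_mul, hKH, cos_pi_div_two_sub, sin_pi_div_two_sub, add_comm]
    have d : dpencil H (π / 2 - t) = -(dpencil K t * H) := by
      simp only [dpencil, add_mul, smul_mul_assoc, hKH, cos_pi_div_two_sub, sin_pi_div_two_sub,
        one_mul]
      module
    rw [logDerivPencil, logDerivPencil, g, d, Ring.inverse_mul (Or.inr hH), neg_mul, neg_neg,
      mul_assoc, Ring.mul_inverse_cancel_left _ _ hH]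
  simp_rw [hpt]
  rw [intervalIntegral.integral_neg, intervalIntegral.integral_comp_sub_left (logDerivPencil H)]
  have := (periodic_logDerivPencil H).intervalIntegral_add_eq (π / 2 - 2 * π) 0
  rw [sub_add_cancel, zero_add] at this
  rw [sub_zero, this]

variable [CompleteSpace A]

theorem continuous_inverse_pencil {H : A} (hH : IsElliptic H) :
    Continuous fun t => Ring.inverse (pencil H t) := by
  refine continuous_iff_continuousAt.2 fun t => ?_
  obtain ⟨v, hv⟩ := hH t
  have := NormedRing.inverse_continuousAt v
  rw [hv] at this
  exact this.comp (continuous_pencil H).continuousAt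

theorem continuous_logDerivPencil {H : A} (hH : IsElliptic H) :
    Continuous (logDerivPencil H) :=
  (continuous_dpencil H).mul (continuous_inverse_pencil hH)

theorem integral_logDerivPencil_mul {H : A} (hH : IsElliptic H) {u : ℝ} (hu : sin u ≠ 0) :
    ∫ s in (0 : ℝ)..2 * π, logDerivPencil H s * logDerivPencil H (s + u) =
      -((2 * π) • (1 : A)) := by
  have hR := continuous_logDerivPencil hH
  have hR' : Continuous fun s => logDerivPencil H (s + u) := hR.comp (by fun_prop)
  have hRR : Continuous fun s => logDerivPencil H s * logDerivPencil H (s + u) := hR.mul hR'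
  have key : ∫ s in (0 : ℝ)..2 * π,
      sin u • (1 + logDerivPencil H s * logDerivPencil H (s + u)) = 0 := by
    simp_rw [logDerivPencil_sub hH]
    rw [intervalIntegral.integral_smul, intervalIntegral.integral_sub
      (hR.intervalIntegrable _ _) (hR'.intervalIntegrable _ _)]
    simp_rw [add_comm _ u]
    rw [integral_logDerivPencil_add, sub_self, smul_zero]
  rw [intervalIntegral.integral_smul, smul_eq_zero_iff_right hu, intervalIntegral.integral_add
    (continuous_const.intervalIntegrable _ _) (hRR.intervalIntegrable _ _)] at key
  rw [intervalIntegral.integral_const, sub_zero] at key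
  exact (neg_eq_of_add_eq_zero_right key).symm

theorem integral_logDerivPencil_sq {H : A} (hH : IsElliptic H) :
    (∫ t in (0 : ℝ)..2 * π, logDerivPencil H t) * (∫ t in (0 : ℝ)..2 * π, logDerivPencil H t) =
      -((2 * π) ^ 2 • (1 : A)) := by
  have hR := continuous_logDerivPencil hH
  have hswap := intervalIntegral_intervalIntegral_swap (a := 0) (b := 2 * π) (c := 0) (d := 2 * π)
    (F := fun s u => logDerivPencil H s * logDerivPencil H (s + u)) (by
      have : Continuous (Function.uncurry
          fun s u => logDerivPencil H s * logDerivPencil H (s + u)) := by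
        unfold Function.uncurry; fun_prop
      refine (this.continuousOn.integrableOn_compact
        (isCompact_uIcc.prod isCompact_uIcc)).mono_set
        (Set.prod_mono Set.uIoc_subset_uIcc Set.uIoc_subset_uIcc))
  have hleft (s : ℝ) : ∫ u in (0 : ℝ)..2 * π, logDerivPencil H s * logDerivPencil H (s + u) =
      logDerivPencil H s * ∫ t in (0 : ℝ)..2 * π, logDerivPencil H t := by
    have hRs : Continuous fun u => logDerivPencil H (s + u) := hR.comp (by fun_prop)
    rw [intervalIntegral_const_mul_of_continuous hRs,
      integral_logDerivPencil_add]
  simp_rw [hleft] at hswap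
  rw [intervalIntegral_mul_const_of_continuous hR] at hswap
  rw [hswap]
  have hae : ∀ᵐ u : ℝ, u ∈ Set.uIoc 0 (2 * π) →
      ∫ s in (0 : ℝ)..2 * π, logDerivPencil H s * logDerivPencil H (s + u) =
        -((2 * π) • (1 : A)) := by
    have hnull : ∀ᵐ u : ℝ, u ∉ Set.range fun n : ℤ => (n : ℝ) * π :=
      (Set.countable_range _).ae_notMem _
    filter_upwards [hnull] with u hu _
    refine integral_logDerivPencil_mul hH fun h0 => hu ?_
    obtain ⟨n, hn⟩ := sin_eq_zero_iff.1 h0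
    exact ⟨n, hn⟩
  rw [intervalIntegral.integral_congr_ae hae, intervalIntegral.integral_const]
  module

theorem commute_integral {f : ℝ → A} (hf : Continuous f) {K : A} (h : ∀ t, Commute K (f t))
    (x y : ℝ) : Commute K (∫ t in x..y, f t) := by
  rw [commute_iff_eq, ← intervalIntegral_const_mul_of_continuous hf,
    ← intervalIntegral_mul_const_of_continuous hf]
  simp_rw [(h _).eq]

/-- If `P` is the polarization of `H`, then `H + P` is invertible. -/
theorem isUnit_add_polarization {H : A} (hH : IsElliptic H) {P : A}
    (hP : P = (2 * π)⁻¹ • ∫ t in (0 : ℝ)..2 * π, logDerivPencil H t) (hP2 : P * P = -1)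
    (hPH : Commute H P) : IsUnit (H + P) := by
  have hN := continuous_inverse_pencil hH
  have hcN : Continuous fun t => cos t • Ring.inverse (pencil H t) := by fun_prop
  have hsN : Continuous fun t => sin t • Ring.inverse (pencil H t) := by fun_prop
  have hHcN : Continuous fun t => H * cos t • Ring.inverse (pencil H t) := by fun_prop
  have hHsN : Continuous fun t => H * sin t • Ring.inverse (pencil H t) := by fun_prop
  have hcH (t : ℝ) : Commute H (Ring.inverse (pencil H t)) :=
    commute_inverse_pencil H (Commute.refl H) t
  have hcP (t : ℝ) : Commute P (Ring.inverse (pencil H t)) :=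
    commute_inverse_pencil H hPH.symm t
  set C : A := (2 * π)⁻¹ • ∫ t in (0 : ℝ)..2 * π, cos t • Ring.inverse (pencil H t) with hC
  set S : A := (2 * π)⁻¹ • ∫ t in (0 : ℝ)..2 * π, sin t • Ring.inverse (pencil H t) with hS
  have hHC : Commute H C := (commute_integral hcN (fun t => (hcH t).smul_right _) _ _).smul_right _
  have hHS : Commute H S := (commute_integral hsN (fun t => (hcH t).smul_right _) _ _).smul_right _
  have hPC : Commute P C := (commute_integral hcN (fun t => (hcP t).smul_right _) _ _).smul_right _
  have hPS : Commute P S := (commute_integral hsN (fun t => (hcP t).smul_right _) _ _).smul_right _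
  have e₁ : C + H * S = 1 := by
    rw [hC, hS, mul_smul_comm, ← intervalIntegral_const_mul_of_continuous hsN, ← smul_add,
      ← intervalIntegral.integral_add (hcN.intervalIntegrable _ _)
        (hHsN.intervalIntegrable _ _)]
    have (t : ℝ) : cos t • Ring.inverse (pencil H t) + H * sin t • Ring.inverse (pencil H t) =
        1 := by
      rw [← Ring.mul_inverse_cancel _ (hH t)]
      nth_rw 3 [pencil]
      simp [add_mul]
    simp_rw [this]
    rw [intervalIntegral.integral_const, sub_zero, smul_smul, inv_mul_cancel₀ (by positivity),
      one_smul]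
  have e₂ : H * C - S = P := by
    rw [hC, hS, hP, mul_smul_comm, ← intervalIntegral_const_mul_of_continuous hcN, ← smul_sub,
      ← intervalIntegral.integral_sub (hHcN.intervalIntegrable _ _)
        (hsN.intervalIntegrable _ _)]
    congr 2
    ext t
    rw [logDerivPencil, dpencil, add_mul]
    simp only [smul_mul_assoc, mul_smul_comm, one_mul]
    module
  have e : (H + P) * (S - P * C) = 2 := by
    have a : (H + P) * (S - P * C) = (C + H * S) - P * (H * C - S) - (1 + P * P) * C := by
      have : H * (P * C) = P * (H * C) := by rw [← mul_assoc, hPH.eq, mul_assoc]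
      simp only [add_mul, mul_sub, one_mul, mul_assoc, this]
      abel
    rw [a, e₁, e₂, hP2]
    norm_num
  have hcomm : Commute (H + P) (S - P * C) :=
    (hHS.sub_right (hPH.mul_right hHC)).add_left
      (hPS.sub_right ((Commute.refl P).mul_right hPC))
  have e' : (H + P) * ((2⁻¹ : ℝ) • (S - P * C)) = 1 := by
    rw [mul_smul_comm, e, ← one_add_one_eq_two (R := A), smul_add, ← add_smul]
    norm_num
  exact ⟨⟨_, _, e', by rw [← (hcomm.smul_right _).eq, e']⟩, rfl⟩

end Polarization

open Polarization in
theorem pol_eq_integral_logDerivPencil {𝔄 : Type*} [NormedRing 𝔄] [NormedAlgebra ℂ 𝔄]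
    [CompleteSpace 𝔄] (H : 𝔄) :
    pol H = (2 * Real.pi)⁻¹ • ∫ t in (0 : ℝ)..2 * Real.pi, logDerivPencil H t :=
  rfl

theorem pol_mul_pol {𝔄 : Type*} [NormedRing 𝔄] [NormedAlgebra ℂ 𝔄] [CompleteSpace 𝔄]
    {H : 𝔄} (hH : Polarization.IsElliptic H) : pol H * pol H = -1 := by
  rw [pol_eq_integral_logDerivPencil, smul_mul_smul_comm,
    Polarization.integral_logDerivPencil_sq hH, smul_neg, smul_smul]
  have : (2 * Real.pi)⁻¹ * (2 * Real.pi)⁻¹ * (2 * Real.pi) ^ 2 = 1 := by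
    field_simp
  rw [this, one_smul]

theorem commute_pol {𝔄 : Type*} [NormedRing 𝔄] [NormedAlgebra ℂ 𝔄] [CompleteSpace 𝔄]
    {H : 𝔄} (hH : Polarization.IsElliptic H) : Commute H (pol H) :=
  (Polarization.commute_integral (Polarization.continuous_logDerivPencil hH)
    (Polarization.commute_logDerivPencil H (Commute.refl H)) _ _).smul_right _

theorem isUnit_add_pol {𝔄 : Type*} [NormedRing 𝔄] [NormedAlgebra ℂ 𝔄] [CompleteSpace 𝔄]
    {H : 𝔄} (hH : Polarization.IsElliptic H) : IsUnit (H + pol H) :=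
  Polarization.isUnit_add_polarization hH (pol_eq_integral_logDerivPencil H) (pol_mul_pol hH)
    (commute_pol hH)

theorem pol_inv {𝔄 : Type*} [NormedRing 𝔄] [NormedAlgebra ℂ 𝔄] [CompleteSpace 𝔄]
    {H K : 𝔄} (hKH : K * H = 1) (hHK : H * K = 1) :
    pol K = -pol H := by
  rw [pol_eq_integral_logDerivPencil, pol_eq_integral_logDerivPencil,
    Polarization.integral_logDerivPencil_inv hKH hHK, smul_neg]

theorem isElliptic_mul_inverse {𝔄 : Type*} [NormedRing 𝔄] [NormedAlgebra ℝ 𝔄] {A₁ A₂ : 𝔄}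
    (h : ∀ a b : ℝ, (a, b) ≠ ((0 : ℝ), (0 : ℝ)) → IsUnit (a • A₁ + b • A₂)) (hA₂ : IsUnit A₂) :
    Polarization.IsElliptic (A₁ * Ring.inverse A₂) := by
  intro t
  have hu := (h (Real.sin t) (Real.cos t) (fun h0 => by
    have h1 := Real.sin_sq_add_cos_sq t
    simp only [Prod.mk.injEq] at h0
    simp [h0.1, h0.2] at h1)).mul hA₂.ringInverse
  rwa [add_comm, add_mul, smul_mul_assoc, smul_mul_assoc, Ring.mul_inverse_cancel _ hA₂] at hu

theorem im_ne_zero_of_mem_spectrum_mul_inverse {𝔄 : Type*} [NormedRing 𝔄] [NormedAlgebra ℂ 𝔄]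
    {A₁ A₂ : 𝔄} (h : ∀ a b : ℝ, (a, b) ≠ ((0 : ℝ), (0 : ℝ)) → IsUnit (a • A₁ + b • A₂))
    (hA₂ : IsUnit A₂) {z : ℂ} (hz : z ∈ spectrum ℂ (A₁ * Ring.inverse A₂)) : z.im ≠ 0 := by
  intro h0
  refine hz ?_
  have hu := (h (-1) z.re (by simp)).mul hA₂.ringInverse
  have hzr : ((z.re : ℝ) : ℂ) = z := Complex.ext rfl (by simp [h0])
  rw [add_comm, add_mul, smul_mul_assoc, smul_mul_assoc, Ring.mul_inverse_cancel _ hA₂, neg_smul,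
    one_smul, ← sub_eq_add_neg, ← Complex.coe_smul, hzr] at hu
  rwa [spectrum.mem_resolventSet_iff, Algebra.algebraMap_eq_smul_one]

theorem stmt16 {𝔄 : Type*} [NormedRing 𝔄] [NormedAlgebra ℂ 𝔄] [CompleteSpace 𝔄]
    (A₁ A₂ : 𝔄)
    (h : ∀ a b : ℝ, (a, b) ≠ ((0 : ℝ), (0 : ℝ)) → IsUnit (a • A₁ + b • A₂)) :
    (∀ z ∈ spectrum ℂ (A₁ * Ring.inverse A₂), z.im ≠ 0) ∧
    (∀ z ∈ spectrum ℂ (A₂ * Ring.inverse A₁), z.im ≠ 0) ∧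
    IsUnit ((2⁻¹ : ℝ) • (A₁ + pol (A₁ * Ring.inverse A₂) * A₂)) ∧
    IsUnit ((2⁻¹ : ℝ) • (A₂ + pol (A₂ * Ring.inverse A₁) * A₁)) ∧
    (((2⁻¹ : ℝ) • (A₂ + pol (A₂ * Ring.inverse A₁) * A₁)) *
        Ring.inverse ((2⁻¹ : ℝ) • (A₁ + pol (A₁ * Ring.inverse A₂) * A₂))) ^ 2 = -1 := by
  have h' : ∀ a b : ℝ, (a, b) ≠ ((0 : ℝ), (0 : ℝ)) → IsUnit (a • A₂ + b • A₁) := fun a b hab => by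
    rw [add_comm]
    exact h b a fun h0 => hab (by simp_all)
  have hA₁ : IsUnit A₁ := by simpa using h 1 0 (by simp)
  have hA₂ : IsUnit A₂ := by simpa using h 0 1 (by simp)
  have hH := isElliptic_mul_inverse h hA₂
  have hKH : A₂ * Ring.inverse A₁ * (A₁ * Ring.inverse A₂) = 1 := by
    rw [mul_assoc, Ring.inverse_mul_cancel_left _ _ hA₁, Ring.mul_inverse_cancel _ hA₂]
  have hHK : A₁ * Ring.inverse A₂ * (A₂ * Ring.inverse A₁) = 1 := by
    rw [mul_assoc, Ring.inverse_mul_cancel_left _ _ hA₂, Ring.mul_inverse_cancel _ hA₁]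
  have hPK := pol_inv hKH hHK
  have hP2 := pol_mul_pol hH
  have hu := isUnit_add_pol hH
  have hHA : A₁ * Ring.inverse A₂ * A₂ = A₁ := Ring.inverse_mul_cancel_right _ _ hA₂
  rw [hPK]
  generalize pol (A₁ * Ring.inverse A₂) = P at *
  have hC₁ : IsUnit ((2⁻¹ : ℝ) • (A₁ + P * A₂)) := by
    have : A₁ + P * A₂ = (A₁ * Ring.inverse A₂ + P) * A₂ := by rw [add_mul, hHA]
    rw [this, ← one_mul (_ * A₂), ← smul_mul_assoc]
    refine IsUnit.mul ?_ (hu.mul hA₂)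
    rw [← Algebra.algebraMap_eq_smul_one]
    exact (IsUnit.mk0 (2⁻¹ : ℝ) (by norm_num)).map _
  have hC₂ : (2⁻¹ : ℝ) • (A₂ + -P * A₁) = -P * ((2⁻¹ : ℝ) • (A₁ + P * A₂)) := by
    rw [mul_smul_comm, mul_add, ← mul_assoc, neg_mul P P, hP2, neg_neg, one_mul, add_comm]
  have hP : IsUnit (-P) :=
    ⟨⟨-P, P, by rw [neg_mul, hP2, neg_neg], by rw [mul_neg, hP2, neg_neg]⟩, rfl⟩
  refine ⟨fun z hz => im_ne_zero_of_mem_spectrum_mul_inverse h hA₂ hz,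
    fun z hz => im_ne_zero_of_mem_spectrum_mul_inverse h' hA₁ hz, hC₁, ?_, ?_⟩
  · rw [hC₂]
    exact hP.mul hC₁
  · rw [hC₂, Ring.mul_inverse_cancel_right _ _ hC₁, sq, neg_mul_neg, hP2]
end

section
/- Let 𝔄 be a unital associative algebra over ℝ, let (Q₁, …, Qₙ) be a Clifford system in 𝔄, and let ω assign to each pair (j, ι) with j ∈ {1, …, n} and ι ∈ {0,1}ⁿ a real number ω_j^ι such that ω_j^ι = 0 whenever ι_j = 0, and Σ_{j=1}^n ω_j^ι = 1 whenever ι ≠ (0, …, 0). Then for every X ∈ 𝔄 whose iterated full symmetrization X⁰_{Q₁}⁰_{Q₂}⋯⁰_{Qₙ} vanishes, one has the connection identity ½ Σ_{j=1}^n Σ_{ι ∈ {0,1}ⁿ} ω_j^ι · (([X, Q_j]·Q_j⁻¹))^ι = X, where for R ∈ 𝔄 and ι ∈ {0,1}ⁿ the element R^ι denotes the iterated composition R^{ι₁}_{Q₁}^{ι₂}_{Q₂}⋯^{ιₙ}_{Qₙ}. -/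
/-- `symA Q ι R` is the symmetrization `R⁰_Q = ½(R + Q⁻¹RQ)` (for `ι = false`, i.e. `ι = 0`)
resp. the antisymmetrization `R¹_Q = ½(R − Q⁻¹RQ)` (for `ι = true`, i.e. `ι = 1`)
of `R` with respect to `Q`. -/
noncomputable def symA {𝔄 : Type*} [Ring 𝔄] [Module ℝ 𝔄] (Q : 𝔄) (ι : Bool) (R : 𝔄) : 𝔄 :=
  if ι then (2⁻¹ : ℝ) • (R - Ring.inverse Q * R * Q)
  else (2⁻¹ : ℝ) • (R + Ring.inverse Q * R * Q)

/-- `iterSym Q ι R = R^{ι₁}_{Q₁}{}^{ι₂}_{Q₂}⋯^{ιₙ}_{Qₙ}`, the iterated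
(anti)symmetrization obtained by applying `R ↦ R^{ι_i}_{Q_i}` successively for
`i = 1, …, n`. -/
noncomputable def iterSym {𝔄 : Type*} [Ring 𝔄] [Module ℝ 𝔄] :
    {n : ℕ} → (Fin n → 𝔄) → (Fin n → Bool) → 𝔄 → 𝔄
  | 0, _, _, R => R
  | _ + 1, Q, ι, R => iterSym (fun i => Q i.succ) (fun i => ι i.succ) (symA (Q 0) (ι 0) R)

theorem Ring.inverse_of_mul_self_eq_neg_one {A : Type*} [Ring A] {Q : A} (h : Q * Q = -1) :
    Ring.inverse Q = -Q :=
  Ring.inverse_unit (⟨Q, -Q, by simp [h], by simp [h]⟩ : Aˣ)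

namespace IsCliffordSystem

variable {𝔄 : Type*} [Ring 𝔄]

theorem mul_self_s18 [Algebra ℝ 𝔄] {n : ℕ} {Q : Fin n → 𝔄} (hQ : IsCliffordSystem Q) (i : Fin n) :
    Q i * Q i = -1 := by
  have h := hQ i i
  rw [if_pos rfl, ← two_smul ℝ (Q i * Q i)] at h
  have h2 : (-2 : 𝔄) = (2 : ℝ) • (-1 : 𝔄) := by
    rw [two_smul, ← one_add_one_eq_two, neg_add]
  rw [h2] at h
  exact smul_right_injective 𝔄 (two_ne_zero' ℝ) h

theorem mul_eq_neg_mul {n : ℕ} {Q : Fin n → 𝔄} (hQ : IsCliffordSystem Q) {i j : Fin n}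
    (hij : i ≠ j) : Q i * Q j = -(Q j * Q i) := by
  have h := hQ i j
  rw [if_neg hij] at h
  exact eq_neg_of_add_eq_zero_left h

theorem tail {n : ℕ} {Q : Fin (n + 1) → 𝔄} (hQ : IsCliffordSystem Q) :
    IsCliffordSystem (fun i => Q i.succ) := by
  intro i j
  simpa using hQ i.succ j.succ

end IsCliffordSystem

section

variable {𝔄 : Type*} [Ring 𝔄] [Algebra ℝ 𝔄]

theorem symA_true {Q : 𝔄} (h : Q * Q = -1) (R : 𝔄) :
    symA Q true R = (2⁻¹ : ℝ) • (R + Q * R * Q) := by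
  simp [symA, Ring.inverse_of_mul_self_eq_neg_one h]

theorem symA_false {Q : 𝔄} (h : Q * Q = -1) (R : 𝔄) :
    symA Q false R = (2⁻¹ : ℝ) • (R - Q * R * Q) := by
  simp [symA, Ring.inverse_of_mul_self_eq_neg_one h, sub_eq_add_neg]

theorem symA_smul (Q : 𝔄) (b : Bool) (r : ℝ) (R : 𝔄) : symA Q b (r • R) = r • symA Q b R := by
  cases b <;> simp [symA, smul_comm r, ← smul_add, ← smul_sub]

theorem symA_false_add_symA_true (Q R : 𝔄) : symA Q false R + symA Q true R = R := by
  simp only [symA, Bool.false_eq_true, if_false, if_true]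
  module

theorem symA_true_idem {Q : 𝔄} (h : Q * Q = -1) (R : 𝔄) :
    symA Q true (symA Q true R) = symA Q true R := by
  have hc : Q * (Q * R * Q) * Q = R := by
    rw [show Q * (Q * R * Q) * Q = (Q * Q) * R * (Q * Q) by noncomm_ring, h]
    simp
  simp only [symA_true h, mul_add, add_mul, mul_smul_comm, smul_mul_assoc, hc]
  module

theorem symA_comm {P Q : 𝔄} (hP : P * P = -1) (hQ : Q * Q = -1) (h : P * Q = -(Q * P))
    (b c : Bool) (R : 𝔄) : symA P b (symA Q c R) = symA Q c (symA P b R) := by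
  have hc : P * (Q * R * Q) * P = Q * (P * R * P) * Q := by
    rw [show P * (Q * R * Q) * P = (P * Q) * R * (Q * P) by noncomm_ring,
      show Q * (P * R * P) * Q = (Q * P) * R * (P * Q) by noncomm_ring, h]
    simp
  cases b <;> cases c <;>
    simp only [symA_true, symA_false, hP, hQ, mul_add, add_mul, mul_sub, sub_mul,
      mul_smul_comm, smul_mul_assoc, hc] <;>
    module

theorem commutator_mul_inverse {Q : 𝔄} (h : Q * Q = -1) (X : 𝔄) :
    (X * Q - Q * X) * Ring.inverse Q = (2 : ℝ) • symA Q true X := by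
  rw [symA_true h, Ring.inverse_of_mul_self_eq_neg_one h, smul_inv_smul₀ two_ne_zero,
    sub_mul, mul_neg, mul_neg, mul_assoc X, h]
  simp

theorem iterSym_smul {n : ℕ} (Q : Fin n → 𝔄) (ι : Fin n → Bool) (r : ℝ) (R : 𝔄) :
    iterSym Q ι (r • R) = r • iterSym Q ι R := by
  induction n generalizing R with
  | zero => rfl
  | succ n ih => simp only [iterSym, symA_smul, ih]

theorem sum_iterSym {n : ℕ} (Q : Fin n → 𝔄) (R : 𝔄) : ∑ ι, iterSym Q ι R = R := by
  induction n generalizing R with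
  | zero => simp [iterSym]
  | succ n ih =>
    rw [← (Fin.consEquiv fun _ => Bool).sum_comp, Fintype.sum_prod_type]
    simp only [iterSym, Fin.consEquiv_apply, Fin.cons_zero, Fin.cons_succ, ih,
      Fintype.sum_bool]
    rw [add_comm, symA_false_add_symA_true]

theorem iterSym_symA_true {n : ℕ} {Q : Fin n → 𝔄} (hQ : IsCliffordSystem Q)
    {ι : Fin n → Bool} {j : Fin n} (hj : ι j = true) (R : 𝔄) :
    iterSym Q ι (symA (Q j) true R) = iterSym Q ι R := by
  induction n generalizing R with
  | zero => exact j.elim0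
  | succ n ih =>
    cases j using Fin.cases with
    | zero => simp only [iterSym, hj, symA_true_idem (hQ.mul_self_s18 0)]
    | succ j =>
      simp only [iterSym]
      rw [symA_comm (hQ.mul_self_s18 0) (hQ.mul_self_s18 j.succ)
        (hQ.mul_eq_neg_mul (Fin.succ_ne_zero j).symm)]
      exact ih hQ.tail (j := j) hj _

end

theorem stmt18 {𝔄 : Type*} [Ring 𝔄] [Algebra ℝ 𝔄] {n : ℕ}
    (Q : Fin n → 𝔄) (hQ : IsCliffordSystem Q)
    (ω : Fin n → (Fin n → Bool) → ℝ)
    (hω0 : ∀ (j : Fin n) (ι : Fin n → Bool), ι j = false → ω j ι = 0)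
    (hω1 : ∀ ι : Fin n → Bool, ι ≠ (fun _ => false) → ∑ j, ω j ι = 1)
    (X : 𝔄) (hX : iterSym Q (fun _ => false) X = 0) :
    (2⁻¹ : ℝ) • ∑ j : Fin n, ∑ ι : Fin n → Bool,
      ω j ι • iterSym Q ι ((X * Q j - Q j * X) * Ring.inverse (Q j)) = X := by
  have hterm (j : Fin n) (ι : Fin n → Bool) :
      ω j ι • iterSym Q ι ((X * Q j - Q j * X) * Ring.inverse (Q j)) =
        (2 : ℝ) • (ω j ι • iterSym Q ι X) := by
    cases hj : ι j with
    | false => simp [hω0 j ι hj]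
    | true =>
      rw [commutator_mul_inverse (hQ.mul_self_s18 j), iterSym_smul, iterSym_symA_true hQ hj, smul_comm]
  simp only [hterm, ← Finset.smul_sum]
  rw [inv_smul_smul₀ two_ne_zero, Finset.sum_comm]
  conv_rhs => rw [← sum_iterSym Q X]
  refine Finset.sum_congr rfl fun ι _ => ?_
  rw [← Finset.sum_smul]
  by_cases hι : ι = fun _ => false
  · rw [hι, hX, smul_zero]
  · rw [hω1 ι hι, one_smul]
end
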